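/- arXiv:2306.00350 — 2 statements merged into one kernel-verified Lean document; each statement's English description precedes it below -/
import Mathlib

section
/- Theorem 1, modification-L case: Fix ε > 0. If π̄_L is a Nash distribution with modification-L with parameter ε, then the score ȳ_* = w(π̄_L) satisfies σ(ȳ_*) = π̄_L, and hence ȳ_* is a rest point of the IESL dynamic, i.e. w(σ(ȳ_*)) = ȳ_*. -/
open scoped Classical BigOperators

noncomputable section

/-- An `n`-player finite-horizon imperfect-information game with simultaneous moves
(a finite-horizon POSG).  `Obs` is the joint-observation kernel, `O0` the initial
joint-observation kernel, `Tr` the transition kernel, `R` the reward functions. -/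
structure POSG where
  n : ℕ
  n_pos : 0 < n
  S : Type
  [S_fin : Fintype S]
  [S_ne : Nonempty S]
  Z : Fin n → Type
  [Z_fin : ∀ i, Fintype (Z i)]
  [Z_ne : ∀ i, Nonempty (Z i)]
  A : Type
  [A_fin : Fintype A]
  [A_ne : Nonempty A]
  T : ℕ
  T_pos : 1 ≤ T
  γ : ℝ
  γ_pos : 0 < γ
  γ_le_one : γ ≤ 1
  ρ : S → ℝ
  ρ_nonneg : ∀ s, 0 ≤ ρ s
  ρ_sum : ∑ s, ρ s = 1
  O0 : S → (∀ i, Z i) → ℝ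
  O0_nonneg : ∀ s z, 0 ≤ O0 s z
  O0_sum : ∀ s, ∑ z, O0 s z = 1
  Tr : S → (Fin n → A) → S → ℝ
  Tr_nonneg : ∀ s a s', 0 ≤ Tr s a s'
  Tr_sum : ∀ s a, ∑ s', Tr s a s' = 1
  Obs : S → (Fin n → A) → S → (∀ i, Z i) → ℝ
  Obs_nonneg : ∀ s a s' z, 0 ≤ Obs s a s' z
  Obs_sum : ∀ s a s', ∑ z, Obs s a s' z = 1
  R : Fin n → S → (Fin n → A) → S → ℝ

attribute [instance] POSG.S_fin POSG.S_ne POSG.Z_fin POSG.Z_ne POSG.A_fin POSG.A_ne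

/-- Softmax choice map with regularization parameter `ε`. -/
def softmax {α : Type*} [Fintype α] (ε : ℝ) (y : α → ℝ) (a : α) : ℝ :=
  Real.exp (y a / ε) / ∑ b, Real.exp (y b / ε)

/-- Negative Gibbs entropy `H(p) = ∑ₐ p a * log (p a)` (with `0 * log 0 = 0`). -/
def negEnt {α : Type*} [Fintype α] (p : α → ℝ) : ℝ := ∑ a, p a * Real.log (p a)

namespace POSG

variable (G : POSG)

/-- Joint actions. -/
abbrev JointAct := Fin G.n → G.A

/-- Tuples of observations, one for each player. -/
abbrev ObsTuple := ∀ i, G.Z i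

/-- Global histories at step `t`:
`h_t = (s_0, z̄_0, ā_0, …, ā_{t-1}, s_t, z̄_t)`. -/
abbrev Hist (t : ℕ) := (Fin (t + 1) → G.S) × (Fin (t + 1) → G.ObsTuple) × (Fin t → G.JointAct)

/-- Local trajectories (information sets) of player `i` at step `t`:
`x_t^i = (z_0^i, a_0^i, …, a_{t-1}^i, z_t^i)`. -/
abbrev LocTraj (i : Fin G.n) (t : ℕ) := (Fin (t + 1) → G.Z i) × (Fin t → G.A)

/-- Reduction of a global history to player `i`'s local trajectory;
`h ∈ x` is expressed as `G.red i h = x`. -/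
def red (i : Fin G.n) {t : ℕ} (h : G.Hist t) : G.LocTraj i t :=
  (fun k => h.2.1 k i, fun k => h.2.2 k i)

/-- A policy of player `i` assigns to every local trajectory a vector of action weights. -/
abbrev Policy (i : Fin G.n) := ∀ t : Fin G.T, G.LocTraj i t.1 → G.A → ℝ

/-- Joint policies. -/
abbrev JointPolicy := ∀ i : Fin G.n, G.Policy i

/-- The score space: one real number for each information-set–action pair. -/
abbrev Score := ∀ i : Fin G.n, ∀ t : Fin G.T, G.LocTraj i t.1 → G.A → ℝ

/-- `p` is a genuine (probability-simplex valued) policy. -/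
def IsPolicy {i : Fin G.n} (p : G.Policy i) : Prop :=
  (∀ t x a, 0 ≤ p t x a) ∧ (∀ t x, ∑ a, p t x a = 1)

def IsJointPolicy (π : G.JointPolicy) : Prop := ∀ i, G.IsPolicy (π i)

/-- Fully mixed joint policy: all actions have positive probability everywhere. -/
def FullyMixed (π : G.JointPolicy) : Prop := ∀ i t x a, 0 < π i t x a

/-- Current (last) state of a history. -/
def lastState {t : ℕ} (h : G.Hist t) : G.S := h.1 (Fin.last t)

/-- Probability of a joint action at a history under a joint policy. -/
def polProb (π : G.JointPolicy) {t : ℕ} (h : G.Hist t) (a : G.JointAct) : ℝ :=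
  if ht : t < G.T then ∏ i, π i ⟨t, ht⟩ (G.red i h) (a i) else 0

/-- Extension of a history by one step. -/
def extend {t : ℕ} (h : G.Hist t) (a : G.JointAct) (s' : G.S) (z' : G.ObsTuple) :
    G.Hist (t + 1) :=
  (Fin.snoc h.1 s', Fin.snoc h.2.1 z', Fin.snoc h.2.2 a)

/-- The one-step-shorter prefix of a history. -/
def front {t : ℕ} (h : G.Hist (t + 1)) : G.Hist t :=
  (fun k => h.1 k.castSucc, fun k => h.2.1 k.castSucc, fun k => h.2.2 k.castSucc)

/-- `Pr(h_t | π̄)`: the product of the initial, transition, observation and policy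
probabilities along the history. -/
def histProb (π : G.JointPolicy) : (t : ℕ) → G.Hist t → ℝ
  | 0, h => G.ρ (h.1 0) * G.O0 (h.1 0) (h.2.1 0)
  | (t + 1), h =>
      histProb π t (G.front h) * G.polProb π (G.front h) (h.2.2 (Fin.last t)) *
        G.Tr (G.lastState (G.front h)) (h.2.2 (Fin.last t)) (G.lastState h) *
        G.Obs (G.lastState (G.front h)) (h.2.2 (Fin.last t)) (G.lastState h)
          (h.2.1 (Fin.last (t + 1)))

/-- Auxiliary (fuel-indexed) value recursion. -/
def valAux (π : G.JointPolicy) (i : Fin G.n) : ℕ → (t : ℕ) → G.Hist t → ℝ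
  | 0, _, _ => 0
  | (fuel + 1), t, h =>
      if t < G.T then
        ∑ a : G.JointAct, ∑ s' : G.S, ∑ z' : G.ObsTuple,
          G.polProb π h a * G.Tr (G.lastState h) a s' * G.Obs (G.lastState h) a s' z' *
            (G.R i (G.lastState h) a s' + G.γ * valAux π i fuel (t + 1) (G.extend h a s' z'))
      else 0

/-- `V^i_π̄(h_t) = E[ ∑_{k=t}^{T-1} γ^{k-t} R^i(s_k, ā_k, s_{k+1}) | h_t, π̄ ]`. -/
def V (π : G.JointPolicy) (i : Fin G.n) {t : ℕ} (h : G.Hist t) : ℝ :=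
  G.valAux π i (G.T - t) t h

/-- `Q^i_π̄(h_t, a^i)`: expected value conditioned on player `i` playing `a^i` at `h_t`
while the other players follow `π̄`. -/
def Q (π : G.JointPolicy) (i : Fin G.n) {t : ℕ} (h : G.Hist t) (ai : G.A) : ℝ :=
  if ht : t < G.T then
    ∑ a : G.JointAct, ∑ s' : G.S, ∑ z' : G.ObsTuple,
      (if a i = ai then ∏ j ∈ Finset.univ.erase i, π j ⟨t, ht⟩ (G.red j h) (a j) else 0) *
        G.Tr (G.lastState h) a s' * G.Obs (G.lastState h) a s' z' *
        (G.R i (G.lastState h) a s' + G.γ * G.V π i (G.extend h a s' z'))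
  else 0

/-- The advantage function `A^i_π̄(h_t, a^i) = Q^i_π̄(h_t, a^i) − V^i_π̄(h_t)`. -/
def Adv (π : G.JointPolicy) (i : Fin G.n) {t : ℕ} (h : G.Hist t) (ai : G.A) : ℝ :=
  G.Q π i h ai - G.V π i h

/-- The initial history determined by `s_0` and `z̄_0`. -/
def hist0 (s : G.S) (z : G.ObsTuple) : G.Hist 0 :=
  (fun _ => s, fun _ => z, fun k => k.elim0)

/-- The utility `u^i(π̄) = E_{h_0}[ V^i_π̄(h_0) ]`. -/
def u (π : G.JointPolicy) (i : Fin G.n) : ℝ :=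
  ∑ s : G.S, ∑ z : G.ObsTuple, G.ρ s * G.O0 s z * G.V π i (G.hist0 s z)

/-- `∑_{h_t ∈ x_t^i} Pr(h_t | π̄)`: reaching probability of an information set. -/
def reach (π : G.JointPolicy) (i : Fin G.n) {t : ℕ} (x : G.LocTraj i t) : ℝ :=
  ∑ h : G.Hist t, if G.red i h = x then G.histProb π t h else 0

/-- `∑_{h_t ∈ x_t^i} Pr(h_t | π̄) A^i_π̄(h_t, a)`. -/
def advW (π : G.JointPolicy) (i : Fin G.n) {t : ℕ} (x : G.LocTraj i t) (a : G.A) : ℝ :=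
  ∑ h : G.Hist t, if G.red i h = x then G.histProb π t h * G.Adv π i h a else 0

/-- The local advantage map `w`. -/
def w (π : G.JointPolicy) : G.Score :=
  fun i t x a => G.advW π i x a / G.reach π i x

/-- The regularized choice map `σ` (softmax with parameter `ε`). -/
def choice (ε : ℝ) (y : G.Score) : G.JointPolicy :=
  fun i t x a => softmax ε (y i t x) a

/-- Assumption: every local trajectory contains some history with positive probability
under fully mixed joint policies. -/
def ReachPos : Prop :=
  ∀ π : G.JointPolicy, G.IsJointPolicy π → G.FullyMixed π →
    ∀ (i : Fin G.n) (t : Fin G.T) (x : G.LocTraj i t.1), 0 < G.reach π i x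

/-- The discounted entropy-regularization term
`ε ∑_{t<T} γ^t ∑_{x_t^i} H(p(x_t^i)) ∑_{h_t ∈ x_t^i} Pr(h_t | π_reach)`. -/
def entReg (ε : ℝ) {i : Fin G.n} (p : G.Policy i) (πreach : G.JointPolicy) : ℝ :=
  ε * ∑ t : Fin G.T, G.γ ^ (t : ℕ) *
    ∑ x : G.LocTraj i t.1, negEnt (p t x) * G.reach πreach i x

/-- Nash distribution with modification-L (parameter `ε`). -/
def NashDistL (ε : ℝ) (πL : G.JointPolicy) : Prop :=
  ∀ (i : Fin G.n) (p : G.Policy i), G.IsPolicy p →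
    G.u πL i - G.entReg ε (πL i) πL ≥
      G.u (Function.update πL i p) i - G.entReg ε p πL

/-- Nash distribution with modification-R (parameter `ε`). -/
def NashDistR (ε : ℝ) (πR : G.JointPolicy) : Prop :=
  ∀ (i : Fin G.n) (p : G.Policy i), G.IsPolicy p →
    G.u πR i - G.entReg ε (πR i) (Function.update πR i p) ≥
      G.u (Function.update πR i p) i - G.entReg ε p (Function.update πR i p)

end POSG

namespace POSG

variable (G : POSG)

lemma gibbs_unique {α : Type*} [Fintype α] [Nonempty α] (ε : ℝ) (hε : 0 < ε) (y p : α → ℝ)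
    (hp0 : ∀ a, 0 ≤ p a) (hp1 : ∑ a, p a = 1)
    (hmax : ∀ q : α → ℝ, (∀ a, 0 ≤ q a) → ∑ a, q a = 1 →
      ∑ a, q a * y a - ε * negEnt q ≤ ∑ a, p a * y a - ε * negEnt p) :
    softmax ε y = p := by
  set Zs : ℝ := ∑ b, Real.exp (y b / ε) with hZ
  have hZpos : 0 < Zs := Finset.sum_pos (fun b _ => Real.exp_pos _) Finset.univ_nonempty
  have hs : ∀ a, softmax ε y a = Real.exp (y a / ε) / Zs := fun a => rfl
  have hspos : ∀ a, 0 < softmax ε y a := fun a => by rw [hs]; positivity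
  have hs1 : ∑ a, softmax ε y a = 1 := by
    simp only [hs]
    rw [← Finset.sum_div, ← hZ, div_self hZpos.ne']
  have hlog : ∀ a, y a = ε * Real.log (softmax ε y a) + ε * Real.log Zs := by
    intro a
    rw [hs, Real.log_div (Real.exp_pos _).ne' hZpos.ne', Real.log_exp]
    field_simp
    ring
  have h := hmax (softmax ε y) (fun a => (hspos a).le) hs1
  have e1 : ∀ q : α → ℝ, ∑ a, q a = 1 → ∑ a, q a * y a - ε * negEnt q =
      ε * Real.log Zs + ε * ∑ a, (q a * Real.log (softmax ε y a) - q a * Real.log (q a)) := by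
    intro q hq
    have : ∑ a, q a * y a = ε * Real.log Zs + ε * ∑ a, q a * Real.log (softmax ε y a) := by
      rw [Finset.mul_sum]
      calc ∑ a, q a * y a = ∑ a, (q a * (ε * Real.log Zs)
            + ε * (q a * Real.log (softmax ε y a))) := by
            refine Finset.sum_congr rfl fun a _ => ?_
            conv_lhs => rw [hlog a]
            ring
        _ = _ := by rw [Finset.sum_add_distrib, ← Finset.sum_mul, hq, one_mul]
    rw [this, negEnt, Finset.sum_sub_distrib]
    ring
  rw [e1 _ hs1, e1 _ hp1] at h
  simp only [sub_self, Finset.sum_const_zero, mul_zero, add_zero] at h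
  have h2 : 0 ≤ ∑ a, (p a * Real.log (softmax ε y a) - p a * Real.log (p a)) := by
    by_contra hc
    push Not at hc
    have := mul_neg_of_pos_of_neg hε hc
    linarith
  have hterm : ∀ a, p a * Real.log (softmax ε y a) - p a * Real.log (p a)
      ≤ softmax ε y a - p a ∧ (p a * Real.log (softmax ε y a) - p a * Real.log (p a)
      = softmax ε y a - p a → softmax ε y a = p a) := by
    intro a
    rcases (hp0 a).eq_or_lt with h0 | h0
    · rw [← h0]
      have := hspos a
      constructor
      · simp; exact this.le
      · intro hh; simp at hh; exact hh.symm
    · have hd : p a * Real.log (softmax ε y a) - p a * Real.log (p a)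
          = p a * Real.log (softmax ε y a / p a) := by
        rw [Real.log_div (hspos a).ne' h0.ne']; ring
      have hd2 : softmax ε y a - p a = p a * (softmax ε y a / p a - 1) := by
        field_simp
      rw [hd]
      have hq := div_pos (hspos a) h0
      constructor
      · rw [hd2]
        exact mul_le_mul_of_nonneg_left (Real.log_le_sub_one_of_pos hq) h0.le
      · intro hh
        by_contra hne
        have : softmax ε y a / p a ≠ 1 := by
          intro h1
          rw [div_eq_one_iff_eq h0.ne'] at h1
          exact hne h1
        have h3 := mul_lt_mul_of_pos_left (Real.log_lt_sub_one_of_pos hq this) h0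
        rw [← hd2] at h3
        linarith
  have hsum0 : ∑ a, (softmax ε y a - p a) = 0 := by
    rw [Finset.sum_sub_distrib, hs1, hp1, sub_self]
  have hle := Finset.sum_le_sum (fun a (_ : a ∈ Finset.univ) => (hterm a).1)
  have heq := (Finset.sum_eq_sum_iff_of_le (fun a (_ : a ∈ Finset.univ) => (hterm a).1)).1
    (le_antisymm hle (by rw [hsum0]; exact h2))
  funext a
  exact (hterm a).2 (heq a (Finset.mem_univ a))

lemma polProb_nonneg {π : G.JointPolicy} (hπ : G.IsJointPolicy π) {t : ℕ} (h : G.Hist t)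
    (a : G.JointAct) : 0 ≤ G.polProb π h a := by
  unfold polProb
  split_ifs
  · exact Finset.prod_nonneg fun i _ => (hπ i).1 _ _ _
  · exact le_rfl

lemma histProb_nonneg {π : G.JointPolicy} (hπ : G.IsJointPolicy π) :
    ∀ (t : ℕ) (h : G.Hist t), 0 ≤ G.histProb π t h
  | 0, h => mul_nonneg (G.ρ_nonneg _) (G.O0_nonneg _ _)
  | (t + 1), h => mul_nonneg (mul_nonneg (mul_nonneg (histProb_nonneg hπ t _)
      (G.polProb_nonneg hπ _ _)) (G.Tr_nonneg _ _ _)) (G.Obs_nonneg _ _ _ _)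

lemma histProb_pos {π μ : G.JointPolicy} :
    ∀ (t : ℕ) (_ : t ≤ G.T) (_ : ∀ (k : Fin G.T), k.1 < t → ∀ i x a, 0 < π i k x a)
      (h : G.Hist t), G.histProb μ t h ≠ 0 → 0 < G.histProb π t h
  | 0, _, _, h, hne => lt_of_le_of_ne (mul_nonneg (G.ρ_nonneg _) (G.O0_nonneg _ _)) (Ne.symm hne)
  | (t + 1), hT, hpos, h, hne => by
      simp only [histProb] at hne ⊢
      have h1 := right_ne_zero_of_mul hne
      have h2 := right_ne_zero_of_mul (left_ne_zero_of_mul hne)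
      have h3 := left_ne_zero_of_mul (left_ne_zero_of_mul (left_ne_zero_of_mul hne))
      have i1 := histProb_pos t (by omega) (fun k hk => hpos k (by omega)) _ h3
      have i2 : 0 < G.polProb π (G.front h) (h.2.2 (Fin.last t)) := by
        unfold polProb
        rw [dif_pos (by omega : t < G.T)]
        exact Finset.prod_pos fun i _ => hpos ⟨t, by omega⟩ (Nat.lt_succ_self t) _ _ _
      exact mul_pos (mul_pos (mul_pos i1 i2) (lt_of_le_of_ne (G.Tr_nonneg _ _ _) h2.symm))
        (lt_of_le_of_ne (G.Obs_nonneg _ _ _ _) h1.symm)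

lemma reach_pos (hreach : G.ReachPos) {π : G.JointPolicy} (hπ : G.IsJointPolicy π)
    (t : Fin G.T) (hpos : ∀ (k : Fin G.T), k.1 < t.1 → ∀ i x a, 0 < π i k x a)
    (i : Fin G.n) (x : G.LocTraj i t.1) : 0 < G.reach π i x := by
  let μ : G.JointPolicy := fun _ _ _ _ => (Fintype.card G.A : ℝ)⁻¹
  have hc : (0 : ℝ) < Fintype.card G.A := by exact_mod_cast Fintype.card_pos
  have hμ : G.IsJointPolicy μ := fun i =>
    ⟨fun _ _ _ => (inv_pos.2 hc).le, fun _ _ => by simp [μ]⟩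
  have h := hreach μ hμ (fun _ _ _ _ => inv_pos.2 hc) i t x
  unfold reach at h ⊢
  obtain ⟨h0, -, hne⟩ := Finset.exists_ne_zero_of_sum_ne_zero h.ne'
  have hr : G.red i h0 = x := by
    by_contra hh
    simp [hh] at hne
  rw [if_pos hr] at hne
  refine Finset.sum_pos' (fun h' _ => ?_) ⟨h0, Finset.mem_univ _, ?_⟩
  · split_ifs
    · exact G.histProb_nonneg hπ _ _
    · exact le_rfl
  · rw [if_pos hr]
    exact G.histProb_pos t.1 t.2.le hpos h0 hne

/-- One-information-set deviation. -/
def dev (π : G.JointPolicy) (i : Fin G.n) (t : Fin G.T) (x : G.LocTraj i t.1) (q : G.A → ℝ) :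
    G.Policy i := Function.update (π i) t (Function.update (π i t) x q)

lemma dev_same (π : G.JointPolicy) (i : Fin G.n) (t : Fin G.T) (x : G.LocTraj i t.1)
    (q : G.A → ℝ) : G.dev π i t x q t x = q := by simp [dev]

lemma dev_ne_time (π : G.JointPolicy) (i : Fin G.n) (t : Fin G.T) (x : G.LocTraj i t.1)
    (q : G.A → ℝ) (k : Fin G.T) (hk : k ≠ t) : G.dev π i t x q k = π i k := by
  simp [dev, Function.update_of_ne hk]

lemma dev_ne (π : G.JointPolicy) (i : Fin G.n) (t : Fin G.T) (x : G.LocTraj i t.1)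
    (q : G.A → ℝ) (y : G.LocTraj i t.1) (hy : y ≠ x) : G.dev π i t x q t y = π i t y := by
  simp [dev, Function.update_of_ne hy]

lemma dev_isPolicy {π : G.JointPolicy} (hπ : G.IsJointPolicy π) (i : Fin G.n) (t : Fin G.T)
    (x : G.LocTraj i t.1) (q : G.A → ℝ) (hq0 : ∀ a, 0 ≤ q a) (hq1 : ∑ a, q a = 1) :
    G.IsPolicy (G.dev π i t x q) := by
  have key : ∀ k y, G.dev π i t x q k y = π i k y ∨ G.dev π i t x q k y = q := by
    intro k y
    by_cases hk : k = t
    · subst hk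
      by_cases hy : y = x
      · subst hy; right; exact G.dev_same _ _ _ _ _
      · left; exact G.dev_ne _ _ _ _ _ _ hy
    · left; rw [G.dev_ne_time _ _ _ _ _ _ hk]
  refine ⟨fun k y a => ?_, fun k y => ?_⟩
  · rcases key k y with h | h <;> rw [h]
    · exact (hπ i).1 _ _ _
    · exact hq0 a
  · rcases key k y with h | h <;> rw [h]
    · exact (hπ i).2 _ _
    · exact hq1

lemma polProb_dev_ne (π : G.JointPolicy) (i : Fin G.n) (t : Fin G.T) (x : G.LocTraj i t.1)
    (q : G.A → ℝ) {k : ℕ} (hk : k ≠ t.1) (h : G.Hist k) (a : G.JointAct) :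
    G.polProb (Function.update π i (G.dev π i t x q)) h a = G.polProb π h a := by
  unfold polProb
  split_ifs with hT
  · refine Finset.prod_congr rfl fun j _ => ?_
    by_cases hj : j = i
    · subst hj
      rw [Function.update_self, G.dev_ne_time]
      intro hh
      exact hk (congrArg Fin.val hh)
    · rw [Function.update_of_ne hj]
  · rfl

lemma polProb_dev_ne' (π : G.JointPolicy) (i : Fin G.n) (t : Fin G.T) (x : G.LocTraj i t.1)
    (q : G.A → ℝ) (h : G.Hist t.1) (hx : G.red i h ≠ x) (a : G.JointAct) :
    G.polProb (Function.update π i (G.dev π i t x q)) h a = G.polProb π h a := by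
  unfold polProb
  rw [dif_pos t.2, dif_pos t.2]
  refine Finset.prod_congr rfl fun j _ => ?_
  by_cases hj : j = i
  · subst hj
    rw [Function.update_self]
    exact congrFun (G.dev_ne π j t x q _ hx) _
  · rw [Function.update_of_ne hj]

lemma polProb_dev_eq (π : G.JointPolicy) (i : Fin G.n) (t : Fin G.T) (x : G.LocTraj i t.1)
    (q : G.A → ℝ) (h : G.Hist t.1) (hx : G.red i h = x) (a : G.JointAct) :
    G.polProb (Function.update π i (G.dev π i t x q)) h a =
      q (a i) * ∏ j ∈ Finset.univ.erase i, π j t (G.red j h) (a j) := by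
  unfold polProb
  rw [dif_pos t.2, ← Finset.mul_prod_erase _ _ (Finset.mem_univ i)]
  congr 1
  · rw [Function.update_self, hx]
    exact congrFun (G.dev_same π i t x q) _
  · refine Finset.prod_congr rfl fun j hj => ?_
    rw [Function.update_of_ne (Finset.ne_of_mem_erase hj)]

lemma valAux_dev (π : G.JointPolicy) (i : Fin G.n) (t : Fin G.T) (x : G.LocTraj i t.1)
    (q : G.A → ℝ) : ∀ (f k : ℕ) (_ : t.1 < k) (h : G.Hist k),
    G.valAux (Function.update π i (G.dev π i t x q)) i f k h = G.valAux π i f k h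
  | 0, _, _, _ => rfl
  | f + 1, k, hk, h => by
      simp only [valAux]
      simp only [G.polProb_dev_ne π i t x q (by omega : k ≠ t.1),
        valAux_dev π i t x q f (k + 1) (by omega)]

lemma V_step (π : G.JointPolicy) (i : Fin G.n) {t : ℕ} (ht : t < G.T) (h : G.Hist t) :
    G.V π i h = ∑ a : G.JointAct, ∑ s' : G.S, ∑ z' : G.ObsTuple,
          G.polProb π h a * G.Tr (G.lastState h) a s' * G.Obs (G.lastState h) a s' z' *
            (G.R i (G.lastState h) a s' + G.γ * G.V π i (G.extend h a s' z')) := by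
  unfold V
  rw [show G.T - t = (G.T - (t + 1)) + 1 by omega]
  simp only [valAux, if_pos ht]

lemma V_dev (π : G.JointPolicy) (i : Fin G.n) (t : Fin G.T) (x : G.LocTraj i t.1)
    (q : G.A → ℝ) {k : ℕ} (hk : t.1 < k) (h : G.Hist k) :
    G.V (Function.update π i (G.dev π i t x q)) i h = G.V π i h :=
  G.valAux_dev π i t x q _ _ hk h

lemma V_dev_ne (π : G.JointPolicy) (i : Fin G.n) (t : Fin G.T) (x : G.LocTraj i t.1)
    (q : G.A → ℝ) (h : G.Hist t.1) (hx : G.red i h ≠ x) :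
    G.V (Function.update π i (G.dev π i t x q)) i h = G.V π i h := by
  rw [G.V_step _ _ t.2, G.V_step _ _ t.2]
  simp only [G.polProb_dev_ne' π i t x q h hx, G.V_dev π i t x q (Nat.lt_succ_self t.1)]

lemma V_dev_eq (π : G.JointPolicy) (i : Fin G.n) (t : Fin G.T) (x : G.LocTraj i t.1)
    (q : G.A → ℝ) (h : G.Hist t.1) (hx : G.red i h = x) :
    G.V (Function.update π i (G.dev π i t x q)) i h = ∑ b, q b * G.Q π i h b := by
  rw [G.V_step _ _ t.2]
  simp only [G.polProb_dev_eq π i t x q h hx, G.V_dev π i t x q (Nat.lt_succ_self t.1)]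
  unfold Q
  simp only [dif_pos t.2, Finset.mul_sum]
  symm
  rw [Finset.sum_comm]
  apply Finset.sum_congr rfl
  intro a _
  rw [Finset.sum_comm]
  apply Finset.sum_congr rfl
  intro s _
  rw [Finset.sum_comm]
  apply Finset.sum_congr rfl
  intro z _
  rw [Finset.sum_eq_single (a i)]
  · rw [if_pos rfl]; ring
  · intro b _ hb
    rw [if_neg (Ne.symm hb)]; ring
  · simp

/-- Histories of length `t+1` decompose. -/
def histEquiv (t : ℕ) :
    (G.Hist t × G.JointAct × G.S × G.ObsTuple) ≃ G.Hist (t + 1) where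
  toFun p := G.extend p.1 p.2.1 p.2.2.1 p.2.2.2
  invFun h := (G.front h, h.2.2 (Fin.last t), G.lastState h, h.2.1 (Fin.last (t + 1)))
  left_inv p := by
    obtain ⟨⟨a, b, c⟩, d, e, f⟩ := p
    simp [extend, front, lastState]
  right_inv h := by
    obtain ⟨a, b, c⟩ := h
    simp only [extend, front, lastState]
    refine Prod.ext ?_ (Prod.ext ?_ ?_)
    · exact Fin.snoc_init_self a
    · exact Fin.snoc_init_self b
    · exact Fin.snoc_init_self c

lemma histProb_extend (π : G.JointPolicy) {t : ℕ} (h : G.Hist t) (a : G.JointAct) (s : G.S)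
    (z : G.ObsTuple) : G.histProb π (t + 1) (G.extend h a s z) =
      G.histProb π t h * (G.polProb π h a * G.Tr (G.lastState h) a s *
        G.Obs (G.lastState h) a s z) := by
  have e : G.front (G.extend h a s z) = h := by
    simp [extend, front]
  simp only [histProb, e]
  have e1 : (G.extend h a s z).2.2 (Fin.last t) = a := by simp [extend]
  have e2 : G.lastState (G.extend h a s z) = s := by simp [extend, lastState]
  have e3 : (G.extend h a s z).2.1 (Fin.last (t + 1)) = z := by simp [extend]
  rw [e1, e2, e3]
  ring

/-- Expected value difference at step `k`. -/
def dDiff (π π' : G.JointPolicy) (i : Fin G.n) (k : ℕ) : ℝ :=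
  ∑ h : G.Hist k, G.histProb π k h * (G.V π' i h - G.V π i h)

lemma dDiff_step (π : G.JointPolicy) (i : Fin G.n) (t : Fin G.T) (x : G.LocTraj i t.1)
    (q : G.A → ℝ) {k : ℕ} (hk : k < t.1) :
    G.dDiff π (Function.update π i (G.dev π i t x q)) i k =
      G.γ * G.dDiff π (Function.update π i (G.dev π i t x q)) i (k + 1) := by
  have hkT : k < G.T := hk.trans t.2
  unfold dDiff
  conv_rhs => rw [← (G.histEquiv k).sum_comp, Fintype.sum_prod_type, Finset.mul_sum]
  refine Finset.sum_congr rfl fun h _ => ?_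
  rw [G.V_step _ _ hkT, G.V_step π _ hkT]
  simp only [G.polProb_dev_ne π i t x q hk.ne]
  rw [Fintype.sum_prod_type]
  simp only [← Finset.sum_sub_distrib, Finset.mul_sum]
  apply Finset.sum_congr rfl
  intro a _
  rw [Fintype.sum_prod_type]
  apply Finset.sum_congr rfl
  intro s _
  apply Finset.sum_congr rfl
  intro z _
  simp only [histEquiv, Equiv.coe_fn_mk, histProb_extend]
  ring

lemma dDiff_zero (π π' : G.JointPolicy) (i : Fin G.n) :
    G.dDiff π π' i 0 = G.u π' i - G.u π i := by
  let e : (G.S × G.ObsTuple) ≃ G.Hist 0 :=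
    { toFun := fun p => G.hist0 p.1 p.2
      invFun := fun h => (h.1 0, h.2.1 0)
      left_inv := fun p => rfl
      right_inv := fun h => by
        refine Prod.ext ?_ (Prod.ext ?_ ?_)
        · funext k; rw [show k = 0 from Fin.ext (by omega)]; rfl
        · funext k; rw [show k = 0 from Fin.ext (by omega)]; rfl
        · funext k; exact k.elim0 }
  unfold dDiff u
  rw [← e.sum_comp, Fintype.sum_prod_type]
  simp only [← Finset.sum_sub_distrib]
  refine Finset.sum_congr rfl fun s _ => Finset.sum_congr rfl fun z _ => ?_
  simp only [e, Equiv.coe_fn_mk, histProb, hist0]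
  ring

lemma u_diff (π : G.JointPolicy) (i : Fin G.n) (t : Fin G.T) (x : G.LocTraj i t.1)
    (q : G.A → ℝ) (hq1 : ∑ a, q a = 1) :
    G.u (Function.update π i (G.dev π i t x q)) i - G.u π i =
      G.γ ^ t.1 * ∑ a, q a * G.advW π i x a := by
  rw [← dDiff_zero]
  have h1 : ∀ k, k ≤ t.1 → G.dDiff π (Function.update π i (G.dev π i t x q)) i 0 =
      G.γ ^ k * G.dDiff π (Function.update π i (G.dev π i t x q)) i k := by
    intro k
    induction k with
    | zero => intro _; simp
    | succ k ih =>
      intro hk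
      rw [ih (by omega), G.dDiff_step π i t x q (by omega), pow_succ, mul_assoc]
  rw [h1 t.1 le_rfl]
  congr 1
  unfold dDiff advW
  simp only [Finset.mul_sum]
  rw [Finset.sum_comm]
  refine Finset.sum_congr rfl fun h _ => ?_
  by_cases hx : G.red i h = x
  · rw [G.V_dev_eq π i t x q h hx]
    simp only [if_pos hx, Adv]
    have : ∑ b, q b * G.Q π i h b - G.V π i h = ∑ b, q b * (G.Q π i h b - G.V π i h) := by
      simp only [mul_sub]
      rw [Finset.sum_sub_distrib, ← Finset.sum_mul, hq1, one_mul]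
    rw [this, Finset.mul_sum]
    exact Finset.sum_congr rfl fun b _ => by ring
  · rw [G.V_dev_ne π i t x q h hx]
    simp [if_neg hx]

lemma advW_mean (π : G.JointPolicy) (hπ : G.IsJointPolicy π) (i : Fin G.n) (t : Fin G.T)
    (x : G.LocTraj i t.1) : ∑ a, π i t x a * G.advW π i x a = 0 := by
  have h := G.u_diff π i t x (π i t x) ((hπ i).2 t x)
  have e : G.dev π i t x (π i t x) = π i := by simp [dev]
  rw [e, Function.update_eq_self, sub_self] at h
  exact (mul_eq_zero.1 h.symm).resolve_left (pow_pos G.γ_pos _).ne'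

lemma entReg_diff (ε : ℝ) (π : G.JointPolicy) (i : Fin G.n) (t : Fin G.T) (x : G.LocTraj i t.1)
    (q : G.A → ℝ) : G.entReg ε (G.dev π i t x q) π - G.entReg ε (π i) π =
      ε * (G.γ ^ t.1 * ((negEnt q - negEnt (π i t x)) * G.reach π i x)) := by
  unfold entReg
  rw [← mul_sub, ← Finset.sum_sub_distrib]
  congr 1
  rw [Finset.sum_eq_single t]
  · rw [← mul_sub, ← Finset.sum_sub_distrib]
    congr 1
    rw [Finset.sum_eq_single x]
    · rw [dev_same]; ring
    · intro y _ hy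
      rw [G.dev_ne _ _ _ _ _ _ hy, sub_self]
    · simp
  · intro k _ hk
    rw [G.dev_ne_time _ _ _ _ _ _ hk, sub_self]
  · simp

lemma local_opt (ε : ℝ) (hε : 0 < ε) (π : G.JointPolicy) (hπ : G.IsJointPolicy π)
    (hL : G.NashDistL ε π) (i : Fin G.n) (t : Fin G.T) (x : G.LocTraj i t.1)
    (hr : 0 < G.reach π i x) : softmax ε (G.w π i t x) = π i t x := by
  refine gibbs_unique ε hε _ _ ((hπ i).1 t x) ((hπ i).2 t x) fun q hq0 hq1 => ?_
  have h := hL i (G.dev π i t x q) (G.dev_isPolicy hπ i t x q hq0 hq1)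
  have h1 := G.u_diff π i t x q hq1
  have h2 := G.entReg_diff ε π i t x q
  have hg := pow_pos G.γ_pos t.1
  have h3 : G.γ ^ t.1 * (∑ a, q a * G.advW π i x a -
      ε * ((negEnt q - negEnt (π i t x)) * G.reach π i x)) ≤ 0 := by
    linarith
  have h4 := nonpos_of_mul_nonpos_right h3 hg
  have e : ∀ p : G.A → ℝ, ∑ a, p a * G.w π i t x a =
      (∑ a, p a * G.advW π i x a) / G.reach π i x := by
    intro p
    rw [Finset.sum_div]
    exact Finset.sum_congr rfl fun a _ => by simp only [w]; ring
  rw [e, e, G.advW_mean π hπ, zero_div]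
  have h5 : (∑ a, q a * G.advW π i x a) / G.reach π i x ≤
      ε * (negEnt q - negEnt (π i t x)) := by
    rw [div_le_iff₀ hr]
    linarith
  linarith

lemma softmax_pos {α : Type*} [Fintype α] [Nonempty α] (ε : ℝ) (y : α → ℝ) (a : α) :
    0 < softmax ε y a :=
  div_pos (Real.exp_pos _) (Finset.sum_pos (fun b _ => Real.exp_pos _) Finset.univ_nonempty)

lemma nash_pos (hreach : G.ReachPos) (ε : ℝ) (hε : 0 < ε) (π : G.JointPolicy)
    (hπ : G.IsJointPolicy π) (hL : G.NashDistL ε π) :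
    ∀ m : ℕ, ∀ (k : Fin G.T), k.1 < m → ∀ i x a, 0 < π i k x a := by
  intro m
  induction m with
  | zero => intro k hk; omega
  | succ m ih =>
    intro k hk i x a
    rw [← G.local_opt ε hε π hπ hL i k x
      (G.reach_pos hreach hπ k (fun j hj => ih j (by omega)) i x)]
    exact softmax_pos _ _ _

end POSG

/-- **Theorem 1, modification-L case.**  Every Nash distribution `π̄_L` with
modification-L (parameter `ε`) satisfies `σ(w(π̄_L)) = π̄_L`, hence the score
`ȳ_* = w(π̄_L)` is a rest point of the IESL dynamic: `w(σ(ȳ_*)) = ȳ_*`. -/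
theorem nashDistL_induces_rest_point (G : POSG) (hreach : G.ReachPos)
    (ε : ℝ) (hε : 0 < ε)
    (πL : G.JointPolicy) (hπL : G.IsJointPolicy πL) (hL : G.NashDistL ε πL) :
    G.choice ε (G.w πL) = πL ∧ G.w (G.choice ε (G.w πL)) = G.w πL := by
  have h : G.choice ε (G.w πL) = πL := by
    funext i t x
    exact G.local_opt ε hε πL hπL hL i t x
      (G.reach_pos hreach hπL t (G.nash_pos hreach ε hε πL hπL hL t.1) i x)
  exact ⟨h, by rw [h]⟩
end
end

section
/- Lemma 3 (per-information-set optimality of modification-R Nash distributions): Fix ε ≥ 0 and let π̄_R be a Nash distribution with modification-R with parameter ε. Then for every player i, every policy π^i ∈ Π^i, and every information set x_t^i: Σ_{a_t^i} π_R^i(x_t^i, a_t^i) Σ_{h_t ∈ x_t^i} Pr(h_t|π̄_R) A^i_{π̄_R}(h_t, a_t^i) − ε H(π_R^i(x_t^i)) Σ_{h_t ∈ x_t^i} Pr(h_t|π̄_R) ≥ Σ_{a_t^i} π^i(x_t^i, a_t^i) Σ_{h_t ∈ x_t^i} Pr(h_t|π̄_R) A^i_{π̄_R}(h_t, a_t^i)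 − ε H(π^i(x_t^i)) Σ_{h_t ∈ x_t^i} Pr(h_t|π̄_R). -/
open scoped Classical BigOperators

noncomputable section

namespace POSG

theorem aux_V_succ (G : POSG) (π : G.JointPolicy) (i : Fin G.n) {t : ℕ} (ht : t < G.T)
    (h : G.Hist t) : G.V π i h =
      ∑ a : G.JointAct, ∑ s' : G.S, ∑ z' : G.ObsTuple,
          G.polProb π h a * G.Tr (G.lastState h) a s' * G.Obs (G.lastState h) a s' z' *
            (G.R i (G.lastState h) a s' + G.γ * G.V π i (G.extend h a s' z')) := by
  have e : G.T - t = (G.T - (t + 1)) + 1 := by omega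
  unfold V
  rw [e, valAux, if_pos ht]

theorem aux_polProb_congr (G : POSG) (π π' : G.JointPolicy) {t : ℕ} (h : G.Hist t)
    (a : G.JointAct) (H : ∀ (ht : t < G.T) j, π j ⟨t, ht⟩ = π' j ⟨t, ht⟩) :
    G.polProb π h a = G.polProb π' h a := by
  unfold polProb
  split_ifs with ht
  · simp only [H ht]
  · rfl

theorem aux_valAux_congr (G : POSG) (π π' : G.JointPolicy) (i : Fin G.n) (m : ℕ)
    (H : ∀ (s : Fin G.T) j, m ≤ s.1 → π j s = π' j s) (f : ℕ) :
    ∀ (t : ℕ) (h : G.Hist t), m ≤ t → G.valAux π i f t h = G.valAux π' i f t h := by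
  induction f with
  | zero => intro t h _; rfl
  | succ f ih =>
    intro t h hm
    simp only [valAux]
    have e : ∀ a, G.polProb π h a = G.polProb π' h a := fun a =>
      G.aux_polProb_congr π π' h a (fun ht j => H ⟨t, ht⟩ j hm)
    simp only [e]
    simp only [ih (t + 1) _ (Nat.le_succ_of_le hm)]

theorem aux_histProb_congr (G : POSG) (π π' : G.JointPolicy) (m : ℕ)
    (H : ∀ (s : Fin G.T) j, s.1 < m → π j s = π' j s) (t : ℕ) :
    ∀ (h : G.Hist t), t ≤ m → G.histProb π t h = G.histProb π' t h := by
  induction t with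
  | zero => intro h _; rfl
  | succ t ih =>
    intro h hm
    simp only [histProb]
    rw [ih _ (by omega), G.aux_polProb_congr π π' _ _ (fun ht j => H ⟨t, ht⟩ j (by simp; omega))]

theorem aux_V_eq_Q (G : POSG) (π π' : G.JointPolicy) (i : Fin G.n) {t : ℕ} (ht : t < G.T)
    (H1 : ∀ (s : Fin G.T) j, t + 1 ≤ s.1 → π' j s = π j s)
    (H2 : ∀ j, j ≠ i → π' j = π j) (h : G.Hist t) :
    G.V π' i h = ∑ a, π' i ⟨t, ht⟩ (G.red i h) a * G.Q π i h a := by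
  rw [G.aux_V_succ π' i ht]
  simp only [Q, dif_pos ht]
  simp only [Finset.mul_sum]
  refine Eq.trans ?_ Finset.sum_comm
  refine Finset.sum_congr rfl fun a _ => ?_
  refine Eq.trans ?_ Finset.sum_comm
  refine Finset.sum_congr rfl fun s _ => ?_
  refine Eq.trans ?_ Finset.sum_comm
  refine Finset.sum_congr rfl fun z _ => ?_
  have e : G.V π' i (G.extend h a s z) = G.V π i (G.extend h a s z) :=
    G.aux_valAux_congr π' π i (t + 1) H1 _ _ _ le_rfl
  rw [e, Finset.sum_eq_single (a i)]
  · rw [if_pos rfl]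
    have e2 : G.polProb π' h a = π' i ⟨t, ht⟩ (G.red i h) (a i) *
        ∏ j ∈ Finset.univ.erase i, π j ⟨t, ht⟩ (G.red j h) (a j) := by
      unfold polProb
      rw [dif_pos ht, ← Finset.mul_prod_erase Finset.univ _ (Finset.mem_univ i)]
      congr 1
      refine Finset.prod_congr rfl fun j hj => ?_
      rw [H2 j (Finset.ne_of_mem_erase hj)]
    rw [e2]; ring
  · intro b _ hb
    rw [if_neg (Ne.symm hb)]; ring
  · intro hb; exact absurd (Finset.mem_univ _) hb

theorem aux_front_extend (G : POSG) {t : ℕ} (h : G.Hist t) (a : G.JointAct) (s : G.S)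
    (z : G.ObsTuple) : G.front (G.extend h a s z) = h := by
  simp [front, extend]

theorem aux_extend_front (G : POSG) {t : ℕ} (h : G.Hist (t + 1)) :
    G.extend (G.front h) (h.2.2 (Fin.last t)) (h.1 (Fin.last (t + 1)))
      (h.2.1 (Fin.last (t + 1))) = h := by
  obtain ⟨s, z, a⟩ := h
  simp only [front, extend]
  refine Prod.ext ?_ (Prod.ext ?_ ?_)
  · exact Fin.snoc_init_self s
  · exact Fin.snoc_init_self z
  · exact Fin.snoc_init_self a

def auxEquiv (G : POSG) (t : ℕ) :
    (G.Hist t × G.JointAct × G.S × G.ObsTuple) ≃ G.Hist (t + 1) where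
  toFun q := G.extend q.1 q.2.1 q.2.2.1 q.2.2.2
  invFun h := (G.front h, h.2.2 (Fin.last t), h.1 (Fin.last (t + 1)), h.2.1 (Fin.last (t + 1)))
  left_inv q := by
    obtain ⟨h, a, s, z⟩ := q
    have e := G.aux_front_extend h a s z
    refine Prod.ext e ?_
    simp [extend]
  right_inv h := G.aux_extend_front h

theorem aux_sum_hist (G : POSG) (t : ℕ) (f : G.Hist (t + 1) → ℝ) :
    ∑ h, f h = ∑ h : G.Hist t, ∑ a : G.JointAct, ∑ s : G.S, ∑ z : G.ObsTuple,
      f (G.extend h a s z) := by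
  rw [← (G.auxEquiv t).sum_comp f, Fintype.sum_prod_type]
  refine Finset.sum_congr rfl fun h _ => ?_
  rw [Fintype.sum_prod_type]
  refine Finset.sum_congr rfl fun a _ => ?_
  rw [Fintype.sum_prod_type]
  rfl

theorem aux_histProb_extend (G : POSG) (π : G.JointPolicy) {t : ℕ} (h : G.Hist t)
    (a : G.JointAct) (s : G.S) (z : G.ObsTuple) :
    G.histProb π (t + 1) (G.extend h a s z) =
      G.histProb π t h * G.polProb π h a * G.Tr (G.lastState h) a s *
        G.Obs (G.lastState h) a s z := by
  rw [histProb, aux_front_extend]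
  simp [extend, lastState]

theorem aux_D_step (G : POSG) (π π' : G.JointPolicy) (i : Fin G.n) {t : ℕ} (ht : t < G.T)
    (H : ∀ j, π' j ⟨t, ht⟩ = π j ⟨t, ht⟩) :
    ∑ h : G.Hist t, G.histProb π t h * (G.V π' i h - G.V π i h) =
      G.γ * ∑ h : G.Hist (t + 1), G.histProb π (t + 1) h * (G.V π' i h - G.V π i h) := by
  rw [aux_sum_hist, Finset.mul_sum]
  refine Finset.sum_congr rfl fun h _ => ?_
  rw [G.aux_V_succ π' i ht, G.aux_V_succ π i ht]
  simp only [← Finset.sum_sub_distrib, Finset.mul_sum]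
  refine Finset.sum_congr rfl fun a _ => Finset.sum_congr rfl fun s _ =>
    Finset.sum_congr rfl fun z _ => ?_
  rw [aux_histProb_extend, G.aux_polProb_congr π' π h a (fun _ => H)]
  ring

theorem aux_D_zero (G : POSG) (π π' : G.JointPolicy) (i : Fin G.n) (t : ℕ) (ht : t ≤ G.T)
    (H : ∀ (s : Fin G.T) j, s.1 < t → π' j s = π j s) :
    ∑ h : G.Hist 0, G.histProb π 0 h * (G.V π' i h - G.V π i h) =
      G.γ ^ t * ∑ h : G.Hist t, G.histProb π t h * (G.V π' i h - G.V π i h) := by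
  induction t with
  | zero => simp
  | succ t ih =>
    rw [ih (by omega) (fun s j hs => H s j (by omega)),
      G.aux_D_step π π' i (show t < G.T by omega) (fun j => H ⟨t, by omega⟩ j (by simp))]
    ring

def auxEquiv0 (G : POSG) : (G.S × G.ObsTuple) ≃ G.Hist 0 where
  toFun q := G.hist0 q.1 q.2
  invFun h := (h.1 0, h.2.1 0)
  left_inv q := rfl
  right_inv h := by
    obtain ⟨s, z, a⟩ := h
    refine Prod.ext ?_ (Prod.ext ?_ ?_)
    · funext k; rw [show k = 0 from Fin.ext (by omega)]; rfl
    · funext k; rw [show k = 0 from Fin.ext (by omega)]; rfl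
    · funext k; exact k.elim0

theorem aux_u_sub (G : POSG) (π π' : G.JointPolicy) (i : Fin G.n) :
    G.u π' i - G.u π i =
      ∑ h : G.Hist 0, G.histProb π 0 h * (G.V π' i h - G.V π i h) := by
  rw [← G.auxEquiv0.sum_comp, Fintype.sum_prod_type]
  unfold u
  simp only [← Finset.sum_sub_distrib]
  refine Finset.sum_congr rfl fun s _ => Finset.sum_congr rfl fun z _ => ?_
  rw [← mul_sub]
  rfl

theorem aux_sum_adv (G : POSG) (π : G.JointPolicy) (i : Fin G.n) {t : ℕ} (x : G.LocTraj i t)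
    (q r : G.A → ℝ) (hqr : ∑ a, q a = ∑ a, r a) :
    (∑ a, q a * G.advW π i x a) - (∑ a, r a * G.advW π i x a) =
      ∑ h : G.Hist t, if G.red i h = x then
        G.histProb π t h * ((∑ a, q a * G.Q π i h a) - ∑ a, r a * G.Q π i h a) else 0 := by
  unfold advW
  simp only [Finset.mul_sum]
  rw [Finset.sum_comm, Finset.sum_comm (s := Finset.univ (α := G.A)), ← Finset.sum_sub_distrib]
  refine Finset.sum_congr rfl fun h _ => ?_
  split_ifs with hx
  · have e : ∀ q : G.A → ℝ, ∑ a, q a * (G.histProb π t h * G.Adv π i h a) =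
        G.histProb π t h * (∑ a, q a * G.Q π i h a) -
          G.histProb π t h * G.V π i h * ∑ a, q a := by
      intro q
      rw [Finset.mul_sum, Finset.mul_sum, ← Finset.sum_sub_distrib]
      refine Finset.sum_congr rfl fun a _ => ?_
      unfold Adv; ring
    rw [e, e, hqr]; ring
  · simp

end POSG

/-- **Lemma 3 (per-information-set optimality of modification-R Nash distributions).**
For every player `i`, policy `π^i`, and information set `x_t^i`:
`∑_a π_R^i(x,a) ∑_{h∈x} Pr(h|π̄_R) A^i_{π̄_R}(h,a) − ε H(π_R^i(x)) ∑_{h∈x} Pr(h|π̄_R)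
 ≥ ∑_a π^i(x,a) ∑_{h∈x} Pr(h|π̄_R) A^i_{π̄_R}(h,a) − ε H(π^i(x)) ∑_{h∈x} Pr(h|π̄_R)`. -/
theorem nashDistR_per_infoset_optimality (G : POSG) (ε : ℝ) (hε : 0 ≤ ε)
    (πR : G.JointPolicy) (hπR : G.IsJointPolicy πR) (hR : G.NashDistR ε πR)
    (i : Fin G.n) (p : G.Policy i) (hp : G.IsPolicy p)
    (t : Fin G.T) (x : G.LocTraj i t.1) :
    (∑ a : G.A, πR i t x a * G.advW πR i x a) -
        ε * negEnt (πR i t x) * G.reach πR i x ≥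
      (∑ a : G.A, p t x a * G.advW πR i x a) -
        ε * negEnt (p t x) * G.reach πR i x := by
  set p' : G.Policy i := Function.update (πR i) t (Function.update (πR i t) x (p t x)) with hp'
  have hpt : p' t = Function.update (πR i t) x (p t x) := by simp [hp']
  have hpx : p' t x = p t x := by simp [hpt]
  have hpy : ∀ y, y ≠ x → p' t y = πR i t y := by
    intro y hy; simp [hpt, hy]
  have hps : ∀ s, s ≠ t → p' s = πR i s := by
    intro s hs; simp [hp', hs]
  have hpol : G.IsPolicy p' := by
    have key : ∀ s y, p' s y = p s y ∨ p' s y = πR i s y := by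
      intro s y
      by_cases hs : s = t
      · subst hs
        by_cases hy : y = x
        · subst hy; exact Or.inl hpx
        · exact Or.inr (hpy y hy)
      · exact Or.inr (by rw [hps s hs])
    constructor
    · intro s y a
      rcases key s y with h | h <;> rw [h]
      · exact hp.1 s y a
      · exact (hπR i).1 s y a
    · intro s y
      rcases key s y with h | h <;> rw [h]
      · exact hp.2 s y
      · exact (hπR i).2 s y
  set π' : G.JointPolicy := Function.update πR i p' with hπ'
  have hi : π' i = p' := by simp [hπ']
  have hj : ∀ j, j ≠ i → π' j = πR j := by
    intro j h; simp [hπ', h]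
  have hst : ∀ (s : Fin G.T) j, s ≠ t → π' j s = πR j s := by
    intro s j hs
    by_cases h : j = i
    · subst h; rw [hi, hps s hs]
    · rw [hj j h]
  have hN : G.u πR i - G.entReg ε (πR i) π' ≥ G.u π' i - G.entReg ε p' π' := hR i p' hpol
  have hreach : G.reach π' i x = G.reach πR i x := by
    unfold POSG.reach
    refine Finset.sum_congr rfl fun h _ => ?_
    rw [G.aux_histProb_congr π' πR t.1
      (fun s j hs => hst s j (by intro e; rw [e] at hs; exact lt_irrefl _ hs)) _ h le_rfl]
  have hent : G.entReg ε p' π' - G.entReg ε (πR i) π' =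
      G.γ ^ (t : ℕ) * (ε * negEnt (p t x) * G.reach πR i x -
        ε * negEnt (πR i t x) * G.reach πR i x) := by
    unfold POSG.entReg
    rw [← mul_sub, ← Finset.sum_sub_distrib, Finset.sum_eq_single t]
    · rw [← mul_sub, ← Finset.sum_sub_distrib, Finset.sum_eq_single x]
      · rw [hpx, hreach]; ring
      · intro y _ hy; rw [hpy y hy]; ring
      · intro h; exact absurd (Finset.mem_univ _) h
    · intro s _ hs; rw [hps s hs]; ring
    · intro h; exact absurd (Finset.mem_univ _) h
  have hu : G.u π' i - G.u πR i = G.γ ^ (t : ℕ) *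
      ((∑ a, p t x a * G.advW πR i x a) - (∑ a, πR i t x a * G.advW πR i x a)) := by
    rw [G.aux_u_sub, G.aux_D_zero πR π' i t.1 t.2.le
      (fun s j hs => hst s j (by intro e; rw [e] at hs; exact lt_irrefl _ hs)),
      G.aux_sum_adv πR i x (p t x) (πR i t x) (by rw [hp.2, (hπR i).2])]
    congr 1
    refine Finset.sum_congr rfl fun h _ => ?_
    rw [G.aux_V_eq_Q πR π' i t.2
      (fun s j hs => hst s j (by intro e; rw [e] at hs; omega)) hj,
      G.aux_V_eq_Q πR πR i t.2 (fun _ _ _ => rfl) (fun _ _ => rfl), hi]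
    split_ifs with hx
    · rw [hx]
      change _ * ((∑ a, p' t x a * _) - _) = _
      rw [hpx]
    · change _ * ((∑ a, p' t (G.red i h) a * _) - ∑ a, πR i t (G.red i h) a * _) = _
      rw [hpy _ hx]; ring
  have hγ : 0 < G.γ ^ (t : ℕ) := pow_pos G.γ_pos _
  have hfin := le_of_mul_le_mul_left (a := G.γ ^ (t : ℕ))
    (b := (∑ a, p t x a * G.advW πR i x a) - (∑ a, πR i t x a * G.advW πR i x a))
    (c := ε * negEnt (p t x) * G.reach πR i x - ε * negEnt (πR i t x) * G.reach πR i x)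
    (by rw [← hu, ← hent]; linarith) hγ
  linarith
end
end
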